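/- arXiv:2103.09997 — 2 statements merged into one kernel-verified Lean document; each statement's English description precedes it below -/
import Mathlib

section
/- Suppose (θ₀,…,θ₆) ∈ (T³)⁷ is such that for each i ∈ {1,2,3} the seven points θ₀ⁱ, θ₁ⁱ, …, θ₆ⁱ of S¹ are pairwise distinct. Then |Θ(θ₀,…,θ₆)| ≤ 11/45. -/
open scoped BigOperators
open scoped Classical

noncomputable section

instance : Fact ((0:ℝ) < 1) := ⟨one_pos⟩

/-- The circle `ℝ/ℤ` with its standard circular order. -/
abbrev S1 : Type := AddCircle (1 : ℝ)

/-- The 3-torus `S¹ × S¹ × S¹`. -/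
abbrev T3 : Type := S1 × S1 × S1

/-- The orientation cocycle on the circle: `1` if `(a,b,c)` are pairwise distinct and
positively oriented, `-1` if pairwise distinct and negatively oriented, `0` otherwise. -/
noncomputable def OrS1 (a b c : S1) : ℝ :=
  if sbtw a b c then 1 else if sbtw c b a then -1 else 0

/-- The cocycle `Θ` on `(T³)⁷`. -/
noncomputable def Theta (θ : Fin 7 → T3) : ℝ :=
  (1 / (Nat.factorial 7 : ℝ)) * ∑ σ : Equiv.Perm (Fin 7),
    ((Equiv.Perm.sign σ : ℤ) : ℝ) *
      (OrS1 (θ (σ 0)).1 (θ (σ 1)).1 (θ (σ 2)).1 *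
       OrS1 (θ (σ 2)).2.1 (θ (σ 3)).2.1 (θ (σ 4)).2.1 *
       OrS1 (θ (σ 4)).2.2 (θ (σ 5)).2.2 (θ (σ 6)).2.2)

/-- The sum of `f p q` over the pairs such that `p` stands before `q` in `l`. -/
def pairSum (f : Fin 6 → Fin 6 → ℤ) : List (Fin 6) → ℤ
  | [] => 0
  | p :: l => (l.map (f p)).sum + pairSum f l

/-- The sign of the comparison of two indices, `0` if they agree. -/
def cmpSign (a b : Fin 6) : ℤ := if a < b then 1 else if b < a then -1 else 0

/-- The sign of the permutation `(x, y, p, q, r, s)` of `Fin 6`, where `x < y` are the two indices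
different from `p, q, r, s`; it is `0` if `p, q, r, s` are not pairwise distinct. -/
def splitSign (p q r s : Fin 6) : ℤ :=
  cmpSign p q * cmpSign p r * cmpSign p s * cmpSign q r * cmpSign q s * cmpSign r s *
    (-1) ^ (p.val + q.val + r.val + s.val)

/-- Branch and bound certificate that `pairSum w m ≤ b` for all orderings `m` of `S`. -/
def boundCheck (w : Fin 6 → Fin 6 → ℤ) : ℕ → List (Fin 6) → ℤ → Bool
  | 0, _, _ => false
  | n + 1, S, b =>
    decide (pairSum (fun p q => ((w p q).natAbs : ℤ)) S ≤ b) ||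
      (!S.isEmpty && S.all fun p =>
        boundCheck w n (S.erase p) (b - ((S.erase p).map (w p)).sum))

theorem cmpSign_swap (a b : Fin 6) : cmpSign a b = -cmpSign b a := by
  unfold cmpSign
  split_ifs <;> first | rfl | (exfalso; order)

theorem splitSign_swap (p q r s : Fin 6) : splitSign p q r s = -splitSign q p r s := by
  unfold splitSign
  rw [cmpSign_swap p q, add_comm p.val q.val]
  ring

theorem pairSum_neg (f : Fin 6 → Fin 6 → ℤ) (l : List (Fin 6)) :
    pairSum (fun p q => -f p q) l = -pairSum f l := by
  induction l with
  | nil => rfl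
  | cons a l ih =>
    have h : (l.map fun q => -f a q).sum = -(l.map (f a)).sum := by
      simp [List.sum_neg, Function.comp_def]
    rw [pairSum, pairSum, ih, h, neg_add]

theorem pairSum_mono {f g : Fin 6 → Fin 6 → ℤ} (h : ∀ p q, f p q ≤ g p q) (l : List (Fin 6)) :
    pairSum f l ≤ pairSum g l := by
  induction l with
  | nil => exact le_rfl
  | cons a l ih => exact add_le_add (List.sum_le_sum fun q _ => h a q) ih

theorem pairSum_perm {f : Fin 6 → Fin 6 → ℤ} (h : ∀ p q, f p q = f q p) {l m : List (Fin 6)}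
    (hlm : l.Perm m) : pairSum f l = pairSum f m := by
  induction hlm with
  | nil => rfl
  | cons a hlm ih => simp only [pairSum, ih, (hlm.map (f a)).sum_eq]
  | swap a b l =>
    simp only [pairSum, List.map_cons, List.sum_cons, h a b]
    ring
  | trans _ _ h₁ h₂ => exact h₁.trans h₂

theorem pairSum_le_of_boundCheck {w : Fin 6 → Fin 6 → ℤ} (hw : ∀ p q, w p q = -w q p) (n : ℕ)
    {S m : List (Fin 6)} {b : ℤ} (hc : boundCheck w n S b = true) (hm : m.Perm S) :
    pairSum w m ≤ b := by
  induction n generalizing S m b with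
  | zero => simp [boundCheck] at hc
  | succ n ih =>
    simp only [boundCheck, Bool.or_eq_true, decide_eq_true_eq, Bool.and_eq_true,
      List.all_eq_true] at hc
    rcases hc with hc | ⟨hS, hc⟩
    · refine le_trans (pairSum_mono (fun p q => Int.le_natAbs) m) (le_of_eq_of_le ?_ hc)
      exact pairSum_perm (fun p q => by rw [hw p q, Int.natAbs_neg]) hm
    · cases m with
      | nil => simp [← hm.nil_eq] at hS
      | cons a m =>
        have hmS : m.Perm (S.erase a) := by simpa using hm.erase a
        have := ih (hc a (hm.subset (by simp))) hmS
        rw [pairSum, (hmS.map (w a)).sum_eq]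
        linarith

theorem boundCheck_permutations : ((List.finRange 6).permutations').all (fun l =>
    boundCheck (fun p q => pairSum (splitSign p q) l) 6 (List.finRange 6) 22) = true := by
  decide +kernel

theorem pairSum_pairSum_splitSign_le {l m : List (Fin 6)} (hl : l.Perm (List.finRange 6))
    (hm : m.Perm (List.finRange 6)) :
    pairSum (fun p q => pairSum (splitSign p q) l) m ≤ 22 := by
  refine pairSum_le_of_boundCheck (fun p q => ?_) 6
    (List.all_eq_true.mp boundCheck_permutations l (List.mem_permutations'.mpr hl)) hm
  rw [← pairSum_neg]
  congr 1
  funext r s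
  exact splitSign_swap p q r s

theorem pairSum_eq_sum {u : Fin 6 → ℝ} (f : Fin 6 → Fin 6 → ℤ) {l : List (Fin 6)}
    (hl : l.Pairwise fun p q => u p < u q) :
    pairSum f l = (l.map fun p => (l.map fun q => if u p < u q then f p q else 0).sum).sum := by
  induction l with
  | nil => rfl
  | cons a l ih =>
    obtain ⟨ha, hl⟩ := List.pairwise_cons.mp hl
    rw [pairSum, ih hl]
    simp only [List.map_cons, List.sum_cons, lt_irrefl, if_false, zero_add]
    congr 1
    · exact congrArg _ (List.map_congr_left fun q hq => (if_pos (ha q hq)).symm)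
    · refine congrArg _ (List.map_congr_left fun p hp => ?_)
      rw [if_neg (ha p hp).not_gt, zero_add]

theorem exists_perm_pairSum_eq {u : Fin 6 → ℝ} (hu : Function.Injective u) :
    ∃ l : List (Fin 6), l.Perm (List.finRange 6) ∧
      ∀ f, pairSum f l = ∑ p, ∑ q, if u p < u q then f p q else 0 := by
  have hl : ((List.finRange 6).insertionSort fun p q => u p ≤ u q).Perm (List.finRange 6) :=
    List.perm_insertionSort _ _
  have : Std.Total fun p q : Fin 6 => u p ≤ u q := ⟨fun p q => le_total (u p) (u q)⟩
  have : IsTrans (Fin 6) fun p q => u p ≤ u q := ⟨fun _ _ _ => le_trans⟩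
  refine ⟨_, hl, fun f => ?_⟩
  rw [pairSum_eq_sum (u := u)]
  · rw [(hl.map _).sum_eq, Fin.sum_univ_def]
    refine congrArg _ (List.map_congr_left fun p _ => ?_)
    rw [(hl.map _).sum_eq, Fin.sum_univ_def]
  · have hs := List.pairwise_insertionSort (fun p q : Fin 6 => u p ≤ u q) (List.finRange 6)
    have hn : List.Pairwise (· ≠ ·) ((List.finRange 6).insertionSort fun p q => u p ≤ u q) :=
      hl.nodup_iff.mpr (List.nodup_finRange 6)
    exact (hs.and hn).imp fun h => lt_of_le_of_ne h.1 (hu.ne h.2)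

theorem sum_splitSign (p q r s : Fin 6) :
    (∑ x : Fin 6, ∑ y : Fin 6, if x < y then
      cmpSign x y * (cmpSign x p * cmpSign x q * cmpSign x r * cmpSign x s) *
        (cmpSign y p * cmpSign y q * cmpSign y r * cmpSign y s) *
        (cmpSign p q * cmpSign p r * cmpSign p s * cmpSign q r * cmpSign q s * cmpSign r s)
      else 0) = splitSign p q r s := by
  have key : ∀ p q r s : Fin 6,
      cmpSign p q * cmpSign p r * cmpSign p s * cmpSign q r * cmpSign q s * cmpSign r s ≠ 0 →
      (∑ x : Fin 6, ∑ y : Fin 6, if x < y then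
        (cmpSign x p * cmpSign x q * cmpSign x r * cmpSign x s) *
        (cmpSign y p * cmpSign y q * cmpSign y r * cmpSign y s) else 0) =
      (-1) ^ (p.val + q.val + r.val + s.val) := by
    decide +kernel
  unfold splitSign
  by_cases h : cmpSign p q * cmpSign p r * cmpSign p s * cmpSign q r * cmpSign q s * cmpSign r s = 0
  · simp [h]
  · rw [← key p q r s h, Finset.mul_sum]
    refine Finset.sum_congr rfl fun x _ => ?_
    rw [Finset.mul_sum]
    refine Finset.sum_congr rfl fun y _ => ?_
    split_ifs with hxy
    · rw [show cmpSign x y = 1 from if_pos hxy]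
      ring
    · rw [mul_zero]

/-- The sign of `(a, b, c, d, e, f)` as a permutation of `Fin 6`, and `0` if it is not one. -/
def tupleSign (a b c d e f : Fin 6) : ℤ :=
  cmpSign a b * (cmpSign a c * cmpSign a d * cmpSign a e * cmpSign a f) *
    (cmpSign b c * cmpSign b d * cmpSign b e * cmpSign b f) *
    (cmpSign c d * cmpSign c e * cmpSign c f * cmpSign d e * cmpSign d f * cmpSign e f)

theorem cmpSign_self (a : Fin 6) : cmpSign a a = 0 := by simp [cmpSign]

theorem tupleSign_perm (σ : Equiv.Perm (Fin 6)) :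
    tupleSign (σ 0) (σ 1) (σ 2) (σ 3) (σ 4) (σ 5) = (Equiv.Perm.sign σ : ℤ) := by
  have h : ∀ j, (∏ i ∈ Finset.Iio j, if σ i < σ j then (1 : ℤ) else -1) =
      ∏ i, if i < j then cmpSign (σ i) (σ j) else 1 := by
    intro j
    rw [← Finset.prod_filter]
    refine Finset.prod_congr (by ext; simp) fun i hi => ?_
    have := σ.injective.ne (Finset.mem_filter.mp hi).2.ne
    unfold cmpSign
    split_ifs <;> first | rfl | (exfalso; order)
  have hs : (Equiv.Perm.sign σ : ℤ) =
      ∏ j, ∏ i ∈ Finset.Iio j, if σ i < σ j then (1 : ℤ) else -1 := by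
    rw [Equiv.Perm.sign_eq_prod_prod_Iio]
    push_cast
    refine Finset.prod_congr rfl fun j _ => Finset.prod_congr rfl fun i _ => ?_
    split_ifs <;> rfl
  rw [hs, Fintype.prod_congr _ _ h]
  simp [Fin.prod_univ_six, tupleSign]
  ring

theorem sum_perm_eq_sum_tupleSign (Φ : Fin 6 → Fin 6 → Fin 6 → Fin 6 → Fin 6 → Fin 6 → ℤ) :
    ∑ σ : Equiv.Perm (Fin 6), (Equiv.Perm.sign σ : ℤ) * Φ (σ 0) (σ 1) (σ 2) (σ 3) (σ 4) (σ 5) =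
      ∑ a, ∑ b, ∑ c, ∑ d, ∑ e, ∑ f, tupleSign a b c d e f * Φ a b c d e f := by
  have h := Fintype.sum_of_injective
    (fun σ : Equiv.Perm (Fin 6) => (σ 0, σ 1, σ 2, σ 3, σ 4, σ 5))
    (fun σ τ h => by
      simp only [Prod.mk.injEq] at h
      ext i
      fin_cases i <;> simp [h])
    (fun σ => (Equiv.Perm.sign σ : ℤ) * Φ (σ 0) (σ 1) (σ 2) (σ 3) (σ 4) (σ 5))
    (fun t => tupleSign t.1 t.2.1 t.2.2.1 t.2.2.2.1 t.2.2.2.2.1 t.2.2.2.2.2 *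
      Φ t.1 t.2.1 t.2.2.1 t.2.2.2.1 t.2.2.2.2.1 t.2.2.2.2.2)
    (by
      rintro ⟨a, b, c, d, e, f⟩ ht
      by_contra hne
      refine ht ?_
      have hs : tupleSign a b c d e f ≠ 0 := left_ne_zero_of_mul hne
      have hinj : Function.Injective ![a, b, c, d, e, f] := by
        have key : ∀ i j, i < j → ![a, b, c, d, e, f] i ≠ ![a, b, c, d, e, f] j := by
          intro i j hij h
          refine hs ?_
          unfold tupleSign
          fin_cases i <;> fin_cases j <;> first | (exfalso; revert hij; decide) | skip
          all_goals
            simp at h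
            subst h
            simp [cmpSign_self]
        intro i j h
        by_contra hij
        rcases lt_or_gt_of_ne hij with hlt | hlt
        · exact key i j hlt h
        · exact key j i hlt h.symm
      exact ⟨Equiv.ofBijective _ (Finite.injective_iff_bijective.mp hinj), rfl⟩)
    (fun σ => by simp only [tupleSign_perm])
  simpa only [Fintype.sum_prod_type] using h

/-- The signed count of the permutations `σ` of `Fin 6` such that `σ 0` precedes `σ 1`, `σ 2`
precedes `σ 3` and `σ 4` precedes `σ 5` in the orders defined by `u`, `v` and `w`. -/
def precSum (u v w : Fin 6 → ℝ) : ℤ :=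
  ∑ σ : Equiv.Perm (Fin 6), (Equiv.Perm.sign σ : ℤ) *
    ((if u (σ 0) < u (σ 1) then 1 else 0) * (if v (σ 2) < v (σ 3) then 1 else 0) *
      (if w (σ 4) < w (σ 5) then 1 else 0))

theorem precSum_comp_perm (u v w : Fin 6 → ℝ) (τ : Equiv.Perm (Fin 6)) :
    precSum (u ∘ τ) (v ∘ τ) (w ∘ τ) = Equiv.Perm.sign τ * precSum u v w := by
  unfold precSum
  symm
  rw [Finset.mul_sum, ← Equiv.sum_comp (Equiv.mulLeft τ)]
  refine Finset.sum_congr rfl fun σ _ => ?_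
  simp only [Equiv.coe_mulLeft, Equiv.Perm.sign_mul, Equiv.Perm.mul_apply, Function.comp_apply,
    Units.val_mul]
  rw [← mul_assoc, ← mul_assoc (Equiv.Perm.sign τ : ℤ), Int.units_coe_mul_self, one_mul]
  rfl

theorem precSum_neg (u v w : Fin 6 → ℝ) : precSum u (-v) w = -precSum u v w := by
  unfold precSum
  rw [← Finset.sum_neg_distrib, ← Equiv.sum_comp (Equiv.mulRight (Equiv.swap (2 : Fin 6) 3))]
  refine Finset.sum_congr rfl fun σ _ => ?_
  have h0 : Equiv.swap (2 : Fin 6) 3 0 = 0 := by decide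
  have h1 : Equiv.swap (2 : Fin 6) 3 1 = 1 := by decide
  have h4 : Equiv.swap (2 : Fin 6) 3 4 = 4 := by decide
  have h5 : Equiv.swap (2 : Fin 6) 3 5 = 5 := by decide
  simp only [Equiv.coe_mulRight, Equiv.Perm.sign_mul, Equiv.Perm.mul_apply, h0, h1, h4, h5,
    Equiv.swap_apply_left, Equiv.swap_apply_right, Pi.neg_apply, neg_lt_neg_iff]
  rw [Equiv.Perm.sign_swap (by decide)]
  split_ifs <;> simp

theorem precSum_eq_of_strictMono {u v w : Fin 6 → ℝ} (hu : StrictMono u) :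
    precSum u v w = ∑ p, ∑ q, if v p < v q then
      ∑ r, ∑ s, if w r < w s then splitSign p q r s else 0 else 0 := by
  unfold precSum
  rw [sum_perm_eq_sum_tupleSign fun a b c d e f => (if u a < u b then 1 else 0) *
    (if v c < v d then 1 else 0) * (if w e < w f then 1 else 0)]
  have hcomm : ∀ Φ : Fin 6 → Fin 6 → Fin 6 → Fin 6 → Fin 6 → Fin 6 → ℤ,
      ∑ a, ∑ b, ∑ c, ∑ d, ∑ e, ∑ f, Φ a b c d e f =
        ∑ c, ∑ d, ∑ e, ∑ f, ∑ a, ∑ b, Φ a b c d e f := by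
    intro Φ
    simp only [← Fintype.sum_prod_type']
    exact Fintype.sum_equiv
      ⟨fun t => (t.2.2.1, t.2.2.2.1, t.2.2.2.2.1, t.2.2.2.2.2, t.1, t.2.1),
        fun t => (t.2.2.2.2.1, t.2.2.2.2.2, t.1, t.2.1, t.2.2.1, t.2.2.2.1),
        fun _ => rfl, fun _ => rfl⟩ _ _ fun _ => rfl
  rw [hcomm]
  refine Finset.sum_congr rfl fun p _ => Finset.sum_congr rfl fun q _ => ?_
  split_ifs with hv
  · refine Finset.sum_congr rfl fun r _ => Finset.sum_congr rfl fun s _ => ?_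
    split_ifs with hw
    · rw [← sum_splitSign]
      refine Finset.sum_congr rfl fun x _ => Finset.sum_congr rfl fun y _ => ?_
      simp only [hu.lt_iff_lt]
      split_ifs
      · simp [tupleSign]
      · simp
    · simp
  · simp

theorem precSum_le_of_strictMono {u v w : Fin 6 → ℝ} (hu : StrictMono u)
    (hv : Function.Injective v) (hw : Function.Injective w) : precSum u v w ≤ 22 := by
  obtain ⟨l, hl, hlw⟩ := exists_perm_pairSum_eq hw
  obtain ⟨m, hm, hmv⟩ := exists_perm_pairSum_eq hv
  rw [precSum_eq_of_strictMono hu]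
  simp only [← hlw, ← hmv]
  exact pairSum_pairSum_splitSign_le hl hm

theorem abs_precSum_le {u v w : Fin 6 → ℝ} (hu : Function.Injective u)
    (hv : Function.Injective v) (hw : Function.Injective w) : |precSum u v w| ≤ 22 := by
  have hτ : StrictMono (u ∘ Tuple.sort u) :=
    (Tuple.monotone_sort u).strictMono_of_injective (hu.comp (Tuple.sort u).injective)
  have h : |precSum u v w| =
      |precSum (u ∘ Tuple.sort u) (v ∘ Tuple.sort u) (w ∘ Tuple.sort u)| := by
    rw [precSum_comp_perm, abs_mul, Int.isUnit_iff_abs_eq.mp (Units.isUnit _), one_mul]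
  have hv' := hv.comp (Tuple.sort u).injective
  have hw' := hw.comp (Tuple.sort u).injective
  rw [h, abs_le']
  refine ⟨precSum_le_of_strictMono hτ hv' hw', ?_⟩
  rw [← precSum_neg]
  exact precSum_le_of_strictMono hτ (neg_injective.comp hv') hw'

/-- The sign of the comparison of `u i` and `u j`. -/
def orderSign (u : Fin 6 → ℝ) (i j : Fin 6) : ℤ :=
  (if u i < u j then 1 else 0) - (if u j < u i then 1 else 0)

theorem sum_perm_sub_swap (Φ : Equiv.Perm (Fin 6) → ℤ) {i j : Fin 6} (hij : i ≠ j) :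
    ∑ σ, (Equiv.Perm.sign σ : ℤ) * (Φ σ - Φ (σ * Equiv.swap i j)) =
      2 * ∑ σ, (Equiv.Perm.sign σ : ℤ) * Φ σ := by
  have h : ∑ σ, (Equiv.Perm.sign σ : ℤ) * Φ (σ * Equiv.swap i j) =
      -∑ σ, (Equiv.Perm.sign σ : ℤ) * Φ σ := by
    rw [← Finset.sum_neg_distrib, ← Equiv.sum_comp (Equiv.mulRight (Equiv.swap i j))]
    refine Finset.sum_congr rfl fun σ _ => ?_
    simp [Equiv.Perm.sign_mul, Equiv.Perm.sign_swap hij, mul_assoc]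
  simp only [mul_sub, Finset.sum_sub_distrib, h]
  ring

theorem sum_perm_orderSign (u v w : Fin 6 → ℝ) :
    ∑ σ : Equiv.Perm (Fin 6), (Equiv.Perm.sign σ : ℤ) * (orderSign u (σ 0) (σ 1) *
      orderSign v (σ 2) (σ 3) * orderSign w (σ 4) (σ 5)) = 8 * precSum u v w := by
  have hne : ∀ {i j k : Fin 6}, k ≠ i → k ≠ j → Equiv.swap i j k = k :=
    Equiv.swap_apply_of_ne_of_ne
  have ho : ∀ (u : Fin 6 → ℝ) i j, (if u i < u j then 1 else 0) - (if u j < u i then 1 else 0) =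
      orderSign u i j := fun _ _ _ => rfl
  have h₁ := sum_perm_sub_swap (fun σ => (if u (σ 0) < u (σ 1) then 1 else 0) *
    orderSign v (σ 2) (σ 3) * orderSign w (σ 4) (σ 5)) (show (0 : Fin 6) ≠ 1 by decide)
  have h₂ := sum_perm_sub_swap (fun σ => (if u (σ 0) < u (σ 1) then 1 else 0) *
    (if v (σ 2) < v (σ 3) then 1 else 0) * orderSign w (σ 4) (σ 5))
    (show (2 : Fin 6) ≠ 3 by decide)
  have h₃ := sum_perm_sub_swap (fun σ => (if u (σ 0) < u (σ 1) then 1 else 0) *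
    (if v (σ 2) < v (σ 3) then 1 else 0) * (if w (σ 4) < w (σ 5) then 1 else 0))
    (show (4 : Fin 6) ≠ 5 by decide)
  simp (discharger := decide) only [Equiv.Perm.mul_apply, Equiv.swap_apply_left,
    Equiv.swap_apply_right, hne, ← sub_mul, ← mul_sub, ho u, ho v, ho w] at h₁ h₂ h₃
  rw [h₁, h₂, h₃, precSum]
  ring

/-- The alternating sum of `F ⊗ G ⊗ H`, evaluated at six of seven points. -/
def altSum (F G H : Fin 7 → Fin 7 → ℝ) (a b c d e f : Fin 7) : ℝ :=
  ∑ σ : Equiv.Perm (Fin 7), ((Equiv.Perm.sign σ : ℤ) : ℝ) *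
    (F (σ a) (σ b) * G (σ c) (σ d) * H (σ e) (σ f))

section

variable (F G H : Fin 7 → Fin 7 → ℝ)

theorem altSum_perm (τ : Equiv.Perm (Fin 7)) (a b c d e f : Fin 7) :
    altSum F G H (τ a) (τ b) (τ c) (τ d) (τ e) (τ f) =
      ((Equiv.Perm.sign τ : ℤ) : ℝ) * altSum F G H a b c d e f := by
  unfold altSum
  symm
  rw [Finset.mul_sum, ← Equiv.sum_comp (Equiv.mulRight τ)]
  refine Finset.sum_congr rfl fun σ _ => ?_
  have h : ((Equiv.Perm.sign τ : ℤ) : ℝ) * ((Equiv.Perm.sign τ : ℤ) : ℝ) = 1 := by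
    exact_mod_cast Int.units_coe_mul_self (Equiv.Perm.sign τ)
  simp only [Equiv.coe_mulRight, Equiv.Perm.sign_mul, Equiv.Perm.mul_apply, Units.val_mul,
    Int.cast_mul]
  linear_combination ((Equiv.Perm.sign σ : ℤ) : ℝ) *
    (F (σ (τ a)) (σ (τ b)) * G (σ (τ c)) (σ (τ d)) * H (σ (τ e)) (σ (τ f))) * h

theorem altSum_eq_zero {a b c d e f : Fin 7}
    (h : ∃ x y, x ≠ y ∧ ∀ k ∈ [a, b, c, d, e, f], k ≠ x ∧ k ≠ y) :
    altSum F G H a b c d e f = 0 := by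
  obtain ⟨x, y, hxy, hx⟩ := h
  have h := altSum_perm F G H (Equiv.swap x y) a b c d e f
  simp only [List.forall_mem_cons] at hx
  obtain ⟨ha, hb, hc, hd, he, hf, -⟩ := hx
  rw [Equiv.swap_apply_of_ne_of_ne ha.1 ha.2, Equiv.swap_apply_of_ne_of_ne hb.1 hb.2,
    Equiv.swap_apply_of_ne_of_ne hc.1 hc.2, Equiv.swap_apply_of_ne_of_ne hd.1 hd.2,
    Equiv.swap_apply_of_ne_of_ne he.1 he.2, Equiv.swap_apply_of_ne_of_ne hf.1 hf.2,
    Equiv.Perm.sign_swap hxy] at h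
  push_cast at h
  linarith

theorem altSum_succAbove (k : Fin 7) :
    altSum F G H (k.succAbove 0) (k.succAbove 1) (k.succAbove 2) (k.succAbove 3) (k.succAbove 4)
      (k.succAbove 5) = (-1) ^ k.val * altSum F G H 1 2 3 4 5 6 := by
  have h := altSum_perm F G H k.cycleRange.symm (Fin.succ 0) (Fin.succ 1) (Fin.succ 2) (Fin.succ 3)
    (Fin.succ 4) (Fin.succ 5)
  simp only [Fin.cycleRange_symm_succ, Equiv.Perm.sign_symm, Fin.sign_cycleRange] at h
  rw [h]
  push_cast
  rfl

theorem sum_coboundary_eq_altSum {f g h : Fin 7 → Fin 7 → Fin 7 → ℝ}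
    (hf : ∀ a b c, f a b c = F b c - F a c + F a b)
    (hg : ∀ a b c, g a b c = G b c - G a c + G a b)
    (hh : ∀ a b c, h a b c = H b c - H a c + H a b) :
    ∑ σ : Equiv.Perm (Fin 7), ((Equiv.Perm.sign σ : ℤ) : ℝ) *
      (f (σ 0) (σ 1) (σ 2) * g (σ 2) (σ 3) (σ 4) * h (σ 4) (σ 5) (σ 6)) =
        7 * altSum F G H 1 2 3 4 5 6 := by
  have key : ∑ σ : Equiv.Perm (Fin 7), ((Equiv.Perm.sign σ : ℤ) : ℝ) *
      (f (σ 0) (σ 1) (σ 2) * g (σ 2) (σ 3) (σ 4) * h (σ 4) (σ 5) (σ 6)) =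
      (altSum F G H 1 2 3 4 5 6 - altSum F G H 0 2 3 4 5 6 + altSum F G H 0 1 3 4 5 6) +
      (altSum F G H 0 1 2 3 5 6 - altSum F G H 0 1 2 3 4 6 + altSum F G H 0 1 2 3 4 5) -
      altSum F G H 0 1 2 4 5 6 +
      (-altSum F G H 1 2 3 4 4 6 + altSum F G H 1 2 3 4 4 5 +
        altSum F G H 0 2 3 4 4 6 - altSum F G H 0 2 3 4 4 5 -
        altSum F G H 0 1 3 4 4 6 + altSum F G H 0 1 3 4 4 5) +
      (-altSum F G H 1 2 2 4 5 6 + altSum F G H 1 2 2 4 4 6 - altSum F G H 1 2 2 4 4 5 +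
        altSum F G H 0 2 2 4 5 6 - altSum F G H 0 2 2 4 4 6 + altSum F G H 0 2 2 4 4 5 +
        altSum F G H 0 1 2 4 4 6 - altSum F G H 0 1 2 4 4 5) +
      (altSum F G H 1 2 2 3 5 6 - altSum F G H 1 2 2 3 4 6 + altSum F G H 1 2 2 3 4 5 -
        altSum F G H 0 2 2 3 5 6 + altSum F G H 0 2 2 3 4 6 - altSum F G H 0 2 2 3 4 5) := by
    simp only [altSum, ← Finset.sum_add_distrib, ← Finset.sum_sub_distrib,
      ← Finset.sum_neg_distrib]
    refine Finset.sum_congr rfl fun σ _ => ?_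
    rw [hf, hg, hh]
    ring
  have s1 : altSum F G H 0 2 3 4 5 6 = (-1) ^ 1 * _ := altSum_succAbove F G H 1
  have s2 : altSum F G H 0 1 3 4 5 6 = (-1) ^ 2 * _ := altSum_succAbove F G H 2
  have s3 : altSum F G H 0 1 2 4 5 6 = (-1) ^ 3 * _ := altSum_succAbove F G H 3
  have s4 : altSum F G H 0 1 2 3 5 6 = (-1) ^ 4 * _ := altSum_succAbove F G H 4
  have s5 : altSum F G H 0 1 2 3 4 6 = (-1) ^ 5 * _ := altSum_succAbove F G H 5
  have s6 : altSum F G H 0 1 2 3 4 5 = (-1) ^ 6 * _ := altSum_succAbove F G H 6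
  simp (discharger := decide) only [key, s1, s2, s3, s4, s5, s6, altSum_eq_zero]
  ring

theorem altSum_eq_sum_perm_six (hF : ∀ i, F 0 i = 0 ∧ F i 0 = 0) (hG : ∀ i, G 0 i = 0 ∧ G i 0 = 0)
    (hH : ∀ i, H 0 i = 0 ∧ H i 0 = 0) :
    altSum F G H 1 2 3 4 5 6 = ∑ σ : Equiv.Perm (Fin 6), ((Equiv.Perm.sign σ : ℤ) : ℝ) *
      (F (σ 0).succ (σ 1).succ * G (σ 2).succ (σ 3).succ * H (σ 4).succ (σ 5).succ) := by
  have h0 : ∀ σ : Equiv.Perm (Fin 7), σ 0 ≠ 0 →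
      F (σ 1) (σ 2) * G (σ 3) (σ 4) * H (σ 5) (σ 6) = 0 := by
    intro σ hσ
    obtain ⟨k, hk⟩ := σ.surjective 0
    fin_cases k
    · exact absurd hk hσ
    all_goals
      simp at hk
      simp [hk, hF, hG, hH]
  unfold altSum
  rw [← Equiv.sum_comp Equiv.Perm.decomposeFin.symm, Fintype.sum_prod_type,
    Finset.sum_eq_single 0]
  · refine Finset.sum_congr rfl fun σ _ => ?_
    have hs : ∀ i, Equiv.Perm.decomposeFin.symm (0, σ) (Fin.succ i) = (σ i).succ := by simp
    rw [Equiv.Perm.decomposeFin.symm_sign, if_pos rfl, one_mul, ← hs, ← hs, ← hs, ← hs, ← hs, ← hs]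
    rfl
  · intro k _ hk
    refine Finset.sum_eq_zero fun σ _ => ?_
    rw [h0 _ (by simpa using hk), mul_zero]
  · simp

end

theorem OrS1_coe {a x y z : ℝ} (hx : x ∈ Set.Ico a (a + 1)) (hy : y ∈ Set.Ico a (a + 1))
    (hz : z ∈ Set.Ico a (a + 1)) :
    OrS1 (x : S1) (y : S1) (z : S1) =
      ((if y < z then 1 else 0) - (if z < y then 1 else 0)) -
      ((if x < z then 1 else 0) - (if z < x then 1 else 0)) +
      ((if x < y then 1 else 0) - (if y < x then 1 else 0)) := by
  have hbtw : ∀ {x y z : ℝ}, x ∈ Set.Ico a (a + 1) → y ∈ Set.Ico a (a + 1) →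
      z ∈ Set.Ico a (a + 1) → (btw (x : S1) (y : S1) (z : S1) ↔
        (if x ≤ y then y else y + 1) ≤ (if x < z then z else z + 1)) := by
    intro x y z hx hy hz
    have h₁ : toIcoMod (one_pos (α := ℝ)) x y = if x ≤ y then y else y + 1 := by
      rw [toIcoMod_eq_iff]
      split_ifs with h
      · exact ⟨⟨h, by linarith [hx.1, hy.2]⟩, 0, by simp⟩
      · exact ⟨⟨by linarith [hx.2, hy.1], by linarith⟩, -1, by simp⟩
    have h₂ : toIocMod (one_pos (α := ℝ)) x z = if x < z then z else z + 1 := by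
      rw [toIocMod_eq_iff]
      split_ifs with h
      · exact ⟨⟨h, by linarith [hx.1, hz.2]⟩, 0, by simp⟩
      · exact ⟨⟨by linarith [hx.2, hz.1], by linarith⟩, -1, by simp⟩
    rw [← h₁, ← h₂]
    exact QuotientAddGroup.btw_coe_iff
  unfold OrS1
  simp only [sbtw_iff_not_btw, hbtw hx hy hz, hbtw hz hy hx]
  obtain ⟨hx₁, hx₂⟩ := hx
  obtain ⟨hy₁, hy₂⟩ := hy
  obtain ⟨hz₁, hz₂⟩ := hz
  rcases lt_trichotomy y z with h₁ | rfl | h₁ <;> rcases lt_trichotomy x y with h₂ | rfl | h₂ <;>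
    (try simp only [lt_irrefl, le_refl, if_true, if_false]) <;>
    split_ifs <;> first | (exfalso; linarith) | norm_num

theorem exists_coe_eq (a : ℝ) (x : S1) : ∃ t ∈ Set.Ico a (a + 1), (t : S1) = x :=
  ⟨AddCircle.equivIco 1 a x, (AddCircle.equivIco 1 a x).2, AddCircle.coe_equivIco⟩

theorem OrS1_eq_sub_add (p x y z : S1) :
    OrS1 x y z = OrS1 p y z - OrS1 p x z + OrS1 p x y := by
  obtain ⟨p, hp, rfl⟩ := exists_coe_eq 0 p
  obtain ⟨x, hx, rfl⟩ := exists_coe_eq 0 x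
  obtain ⟨y, hy, rfl⟩ := exists_coe_eq 0 y
  obtain ⟨z, hz, rfl⟩ := exists_coe_eq 0 z
  rw [OrS1_coe hx hy hz, OrS1_coe hp hy hz, OrS1_coe hp hx hz, OrS1_coe hp hx hy]
  ring

theorem OrS1_self_left (p x : S1) : OrS1 p p x = 0 := by
  obtain ⟨p, hp, rfl⟩ := exists_coe_eq 0 p
  obtain ⟨x, hx, rfl⟩ := exists_coe_eq 0 x
  rw [OrS1_coe hp hp hx]
  simp

theorem OrS1_self_outer (p x : S1) : OrS1 p x p = 0 := by
  obtain ⟨p, hp, rfl⟩ := exists_coe_eq 0 p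
  obtain ⟨x, hx, rfl⟩ := exists_coe_eq 0 x
  rw [OrS1_coe hp hx hp]
  simp

theorem exists_orderSign_eq {x : Fin 7 → S1} (hx : Function.Injective x) :
    ∃ u : Fin 6 → ℝ, Function.Injective u ∧
      ∀ i j, OrS1 (x 0) (x i.succ) (x j.succ) = (orderSign u i j : ℤ) := by
  obtain ⟨a, -, ha⟩ := exists_coe_eq 0 (x 0)
  choose u hu hux using fun i : Fin 6 => exists_coe_eq a (x i.succ)
  have hau : ∀ i, a < u i := fun i =>
    lt_of_le_of_ne (hu i).1 fun h => Fin.succ_ne_zero i (hx (by rw [← hux, ← h, ha]))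
  refine ⟨u, fun i j h => Fin.succ_injective _ (hx (by rw [← hux, ← hux, h])), fun i j => ?_⟩
  rw [← hux, ← hux, ← ha, OrS1_coe (by simp) (hu i) (hu j)]
  simp only [hau, (hau _).not_gt, if_true, if_false, orderSign]
  push_cast
  ring

/-- If for each `i ∈ {1,2,3}` the seven `i`-th coordinates are pairwise distinct, then
`|Θ(θ₀,…,θ₆)| ≤ 11/45`. -/
theorem abs_Theta_le_of_injective (θ : Fin 7 → T3)
    (h1 : Function.Injective fun j => (θ j).1)
    (h2 : Function.Injective fun j => (θ j).2.1)
    (h3 : Function.Injective fun j => (θ j).2.2) :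
    |Theta θ| ≤ 11 / 45 := by
  obtain ⟨u, hu, hu'⟩ := exists_orderSign_eq h1
  obtain ⟨v, hv, hv'⟩ := exists_orderSign_eq h2
  obtain ⟨w, hw, hw'⟩ := exists_orderSign_eq h3
  have key : Theta θ = (56 * precSum u v w : ℤ) / 5040 := by
    unfold Theta
    rw [sum_coboundary_eq_altSum (fun i j => OrS1 (θ 0).1 (θ i).1 (θ j).1)
      (fun i j => OrS1 (θ 0).2.1 (θ i).2.1 (θ j).2.1)
      (fun i j => OrS1 (θ 0).2.2 (θ i).2.2 (θ j).2.2)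
      (f := fun a b c => OrS1 (θ a).1 (θ b).1 (θ c).1)
      (g := fun a b c => OrS1 (θ a).2.1 (θ b).2.1 (θ c).2.1)
      (h := fun a b c => OrS1 (θ a).2.2 (θ b).2.2 (θ c).2.2)
      (fun _ _ _ => OrS1_eq_sub_add _ _ _ _) (fun _ _ _ => OrS1_eq_sub_add _ _ _ _)
      (fun _ _ _ => OrS1_eq_sub_add _ _ _ _),
      altSum_eq_sum_perm_six _ _ _ (fun _ => ⟨OrS1_self_left _ _, OrS1_self_outer _ _⟩)
      (fun _ => ⟨OrS1_self_left _ _, OrS1_self_outer _ _⟩)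
      (fun _ => ⟨OrS1_self_left _ _, OrS1_self_outer _ _⟩)]
    simp only [hu', hv', hw']
    rw [show (56 * precSum u v w : ℤ) = 7 * (8 * precSum u v w) by ring, ← sum_perm_orderSign]
    push_cast [Nat.factorial]
    ring
  have hle : |((precSum u v w : ℤ) : ℝ)| ≤ 22 := by exact_mod_cast abs_precSum_le hu hv hw
  rw [key, abs_le]
  rw [abs_le] at hle
  push_cast
  constructor <;> linarith
end
end

section
/- For all θ₀,…,θ₆ ∈ T³ one has Θ(θ₀,…,θ₆) = (1/7!) · ∑_{σ ∈ Sym({0,…,6})} sign(σ) · Or(θ_{σ(0)}¹, θ_{σ(1)}¹, θ_{σ(2)}¹) · Or(θ_{σ(0)}², θ_{σ(3)}², θ_{σ(4)}²) · Or(θ_{σ(4)}³, θ_{σ(5)}³, θ_{σ(6)}³); that is, in the second factor the index σ(2) may be replaced by σ(0) without changing the sum. -/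
open scoped BigOperators
open scoped Classical

noncomputable section

/-- `OrS1` changes sign when its outer arguments are exchanged. -/
theorem OrS1_reverse (a b c : S1) : OrS1 c b a = -OrS1 a b c := by
  unfold OrS1
  by_cases h₁ : sbtw a b c
  · simp [h₁, h₁.not_sbtw]
  · by_cases h₂ : sbtw c b a <;> simp [h₁, h₂]

/-- In the definition of `Θ`, the index `σ(2)` in the second factor may be replaced by
`σ(0)` without changing the sum. -/
theorem Theta_eq_sum_zero_index (θ : Fin 7 → T3) :
    Theta θ = (1 / (Nat.factorial 7 : ℝ)) * ∑ σ : Equiv.Perm (Fin 7),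
      ((Equiv.Perm.sign σ : ℤ) : ℝ) *
        (OrS1 (θ (σ 0)).1 (θ (σ 1)).1 (θ (σ 2)).1 *
         OrS1 (θ (σ 0)).2.1 (θ (σ 3)).2.1 (θ (σ 4)).2.1 *
         OrS1 (θ (σ 4)).2.2 (θ (σ 5)).2.2 (θ (σ 6)).2.2) := by
  unfold Theta
  congr 1
  refine Fintype.sum_equiv (Equiv.mulRight (Equiv.swap (0 : Fin 7) 2)) _ _ fun σ => ?_
  have h₁ : Equiv.swap (0 : Fin 7) 2 1 = 1 := by decide
  have h₃ : Equiv.swap (0 : Fin 7) 2 3 = 3 := by decide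
  have h₄ : Equiv.swap (0 : Fin 7) 2 4 = 4 := by decide
  have h₅ : Equiv.swap (0 : Fin 7) 2 5 = 5 := by decide
  have h₆ : Equiv.swap (0 : Fin 7) 2 6 = 6 := by decide
  have h_sign : Equiv.Perm.sign (Equiv.swap (0 : Fin 7) 2) = -1 :=
    Equiv.Perm.sign_swap (by decide)
  simp only [Equiv.coe_mulRight, Equiv.Perm.mul_apply, Equiv.swap_apply_left,
    Equiv.swap_apply_right, h₁, h₃, h₄, h₅, h₆, Equiv.Perm.sign_mul, h_sign]
  rw [OrS1_reverse (θ (σ 0)).1]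
  push_cast
  ring
end
end
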